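/- arXiv:2405.11556 — 4 statements merged into one kernel-verified Lean document; each statement's English description precedes it below -/
import Mathlib

section
/- Let A be an n×n positive semidefinite matrix with all entries real and factor width at most 2. Then the complex factor-width-2 rank of A equals its real factor-width-2 rank: fran_2^ℂ(A) = fran_2^ℝ(A). That is, the least r for which A = Σ_{j=1}^r v_j v_j* with v_j ∈ ℂⁿ each having at most 2 nonzero entries equals the least r for which A = Σ_{j=1}^r w_j w_jᵀ with w_j ∈ ℝⁿ each having at most 2 nonzero entries. -/
open Matrix
open scoped ComplexOrder

variable {𝕜 : Type*} [RCLike 𝕜] {n : ℕ}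

/-- `A` has a decomposition as a sum of `r` outer products `v_j v_j*` where each
vector `v_j` has at most `k` nonzero entries. -/
def HasFWDecomp (k r : ℕ) (A : Matrix (Fin n) (Fin n) 𝕜) : Prop :=
  ∃ v : Fin r → (Fin n → 𝕜),
    (∀ j, ({i | v j i ≠ 0} : Set (Fin n)).ncard ≤ k) ∧
    A = ∑ j, Matrix.vecMulVec (v j) (star (v j))

/-- `A` has factor width at most `k`. -/
def FactorWidthAtMost (k : ℕ) (A : Matrix (Fin n) (Fin n) 𝕜) : Prop :=
  ∃ r, HasFWDecomp k r A

/-- The factor-width-`k` rank of `A`: the least number of terms in a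
factor-width-`k` decomposition of `A`. -/
noncomputable def fran (k : ℕ) (A : Matrix (Fin n) (Fin n) 𝕜) : ℕ :=
  sInf {r | HasFWDecomp k r A}

/-- The factor width of `A`: the least `k` such that `A` has factor width at most `k`. -/
noncomputable def FactorWidth (A : Matrix (Fin n) (Fin n) 𝕜) : ℕ :=
  sInf {k | FactorWidthAtMost k A}

/-- The Gram matrix of two complex vectors with real inner product is also the Gram matrix of two
real vectors of the same length. -/
lemma exists_real_gram {ι : Type*} [DecidableEq ι] (J : Finset ι) (x y : ι → ℂ)
    (him : (∑ j ∈ J, x j * star (y j)).im = 0) :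
    ∃ p q : ι → ℝ, ∑ j ∈ J, p j * p j = (∑ j ∈ J, x j * star (x j)).re ∧
      ∑ j ∈ J, q j * q j = (∑ j ∈ J, y j * star (y j)).re ∧
      ∑ j ∈ J, p j * q j = (∑ j ∈ J, x j * star (y j)).re := by
  have hnorm (z : ι → ℂ) : (∑ j ∈ J, z j * star (z j)).re = ∑ j ∈ J, ‖z j‖ ^ 2 := by
    simp [← Complex.normSq_eq_norm_sq, Complex.normSq_apply]
  rw [hnorm, hnorm]
  set Z := (∑ j ∈ J, x j * star (y j)).re with hZ
  set X := ∑ j ∈ J, ‖x j‖ ^ 2 with hX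
  set Y := ∑ j ∈ J, ‖y j‖ ^ 2 with hY
  have hX0 : 0 ≤ X := Finset.sum_nonneg fun _ _ => by positivity
  have hY0 : 0 ≤ Y := Finset.sum_nonneg fun _ _ => by positivity
  have hZle : Z ^ 2 ≤ X * Y := by
    have h1 : |Z| ≤ ∑ j ∈ J, ‖x j‖ * ‖y j‖ := by
      refine (Complex.abs_re_le_norm _).trans ((norm_sum_le _ _).trans_eq ?_)
      simp
    calc Z ^ 2 = |Z| ^ 2 := (sq_abs Z).symm
      _ ≤ (∑ j ∈ J, ‖x j‖ * ‖y j‖) ^ 2 := by gcongr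
      _ ≤ X * Y := Finset.sum_mul_sq_le_sq_mul_sq J _ _
  have hXX : √X * √X = X := Real.mul_self_sqrt hX0
  have hYY : √Y * √Y = Y := Real.mul_self_sqrt hY0
  have hZX : √X * (Z / √X) = Z := by
    rcases hX0.eq_or_lt with h0 | h0
    · have : Z = 0 := by nlinarith
      simp [this]
    · have := Real.sqrt_pos.2 h0
      field_simp
  have hsq : Z / √X * (Z / √X) = Z ^ 2 / X := by
    rw [div_mul_div_comm, hXX, sq]
  have hYZ : 0 ≤ Y - Z ^ 2 / X := by
    rcases hX0.eq_or_lt with h0 | h0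
    · simpa [← h0] using hY0
    · rw [sub_nonneg, div_le_iff₀ h0]
      linarith
  rcases J.eq_empty_or_nonempty with rfl | hne
  · exact ⟨0, 0, by simp [hX, hY, hZ]⟩
  obtain ⟨k, hk⟩ := hne
  by_cases hcard : ∃ l ∈ J, l ≠ k
  · obtain ⟨l, hl, hlk⟩ := hcard
    refine ⟨Pi.single k √X, Pi.single k (Z / √X) + Pi.single l √(Y - Z ^ 2 / X), ?_, ?_, ?_⟩
    · simp [Pi.single_apply, hk, hXX]
    · simp [Pi.single_apply, hk, hl, hlk, hlk.symm, mul_add, add_mul, Finset.sum_add_distrib, hsq,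
        Real.mul_self_sqrt hYZ]
    · simp [Pi.single_apply, hk, hl, hlk, mul_add, Finset.sum_add_distrib, hZX]
  · have hJ : J = {k} := by
      push Not at hcard
      exact Finset.eq_singleton_iff_unique_mem.2 ⟨hk, hcard⟩
    subst hJ
    rcases hX0.eq_or_lt with h0 | h0
    · have : Z = 0 := by nlinarith
      exact ⟨0, fun _ => √Y, by simp [← h0], by simp [hYY], by simp [this]⟩
    · have hZeq : Z ^ 2 = X * Y := by
        simp only [hX, hY, hZ, Finset.sum_singleton] at him ⊢
        rw [← mul_pow, ← norm_star (y k), ← norm_mul, ← Complex.normSq_eq_norm_sq,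
          Complex.normSq_apply, him]
        ring
      refine ⟨fun _ => √X, fun _ => Z / √X, by simp [hXX], ?_, by simp [hZX]⟩
      rw [Finset.sum_singleton, hsq, hZeq, mul_div_cancel_left₀ _ h0.ne']

/-- A sum of complex outer products supported on a common set of at most two indices, if its
off-diagonal entries are real, is a sum of equally many real outer products supported there. -/
lemma exists_real_outer_sum {ι κ : Type*} [DecidableEq ι] [DecidableEq κ] (J : Finset ι)
    (s : Finset κ) (hs : s.card ≤ 2) (v : ι → κ → ℂ) (hv : ∀ j ∈ J, ∀ a ∉ s, v j a = 0)
    (him : ∀ a b, a ≠ b → (∑ j ∈ J, v j a * star (v j b)).im = 0) :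
    ∃ w : ι → κ → ℝ, (∀ j, ∀ a ∉ s, w j a = 0) ∧
      ∀ a b, ∑ j ∈ J, w j a * w j b = (∑ j ∈ J, v j a * star (v j b)).re := by
  have hzero (a b : κ) (h : a ∉ s ∨ b ∉ s) : ∑ j ∈ J, v j a * star (v j b) = 0 := by
    refine Finset.sum_eq_zero fun j hj => ?_
    rcases h with h | h <;> simp [hv j hj _ h]
  rcases Nat.lt_or_ge s.card 2 with hs1 | hs2
  · refine ⟨fun j a => if a ∈ s then ‖v j a‖ else 0, fun j a ha => if_neg ha, fun a b => ?_⟩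
    by_cases hab : a ∈ s ∧ b ∈ s
    · obtain rfl : a = b := Finset.card_le_one.1 (by omega) a hab.1 b hab.2
      simp [hab.1, Complex.norm_mul_self_eq_normSq, Complex.normSq_apply]
    · rw [not_and_or] at hab
      rw [hzero a b hab]
      rcases hab with h | h <;> simp [h]
  · obtain ⟨c, d, hcd, rfl⟩ := Finset.card_eq_two.1 (le_antisymm hs hs2)
    obtain ⟨p, q, hpp, hqq, hpq⟩ := exists_real_gram J (v · c) (v · d) (him c d hcd)
    have hsymm : (∑ j ∈ J, v j d * star (v j c)).re = (∑ j ∈ J, v j c * star (v j d)).re := by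
      simp [mul_comm]
    refine ⟨fun j a => if a = c then p j else if a = d then q j else 0, fun j a ha => ?_,
      fun a b => ?_⟩
    · simp only [Finset.mem_insert, Finset.mem_singleton, not_or] at ha
      simp [ha.1, ha.2]
    · by_cases hab : a ∈ ({c, d} : Finset κ) ∧ b ∈ ({c, d} : Finset κ)
      · simp only [Finset.mem_insert, Finset.mem_singleton] at hab
        obtain ⟨rfl | rfl, rfl | rfl⟩ := hab
        · simpa using hpp
        · simpa [hcd.symm] using hpq
        · rw [hsymm, ← hpq]
          simp [hcd.symm, mul_comm]
        · simpa [hcd.symm] using hqq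
      · rw [not_and_or] at hab
        rw [hzero a b hab]
        simp only [Finset.mem_insert, Finset.mem_singleton, not_or] at hab
        rcases hab with h | h <;> simp [h.1, h.2]

lemma HasFWDecomp.map_ofReal {k r : ℕ} {A : Matrix (Fin n) (Fin n) ℝ} (h : HasFWDecomp k r A) :
    HasFWDecomp k r (A.map (Complex.ofReal ·)) := by
  obtain ⟨w, hw, rfl⟩ := h
  refine ⟨fun j i => (w j i : ℂ), by simpa using hw, ?_⟩
  ext a b
  simp [Matrix.sum_apply, Matrix.vecMulVec_apply]

lemma HasFWDecomp.of_map_ofReal {r : ℕ} {A : Matrix (Fin n) (Fin n) ℝ}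
    (h : HasFWDecomp 2 r (A.map (Complex.ofReal ·))) : HasFWDecomp 2 r A := by
  classical
  obtain ⟨v, hv, hA⟩ := h
  have hentry (a b : Fin n) : ∑ j, v j a * star (v j b) = (A a b : ℂ) := by
    have := congrFun (congrFun hA a) b
    simpa [Matrix.sum_apply, Matrix.vecMulVec_apply] using this.symm
  let S (j : Fin r) : Finset (Fin n) := {i | v j i ≠ 0}
  have hmem (j : Fin r) (a : Fin n) : a ∈ S j ↔ v j a ≠ 0 := by simp [S]
  have hS (j : Fin r) : (S j).card ≤ 2 := by
    rw [← Set.ncard_coe_finset]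
    simpa [S] using hv j
  have him (s : Finset (Fin n)) (hs : s.card ≤ 2) (a b : Fin n) (hab : a ≠ b) :
      (∑ j with S j = s, v j a * star (v j b)).im = 0 := by
    have hpair (t : Finset (Fin n)) (ht : t.card ≤ 2) (ha : a ∈ t) (hb : b ∈ t) : {a, b} = t :=
      Finset.eq_of_subset_of_card_le (by simp [Finset.insert_subset_iff, ha, hb])
        (by rwa [Finset.card_pair hab])
    by_cases hmem' : a ∈ s ∧ b ∈ s
    · rw [Finset.sum_filter_of_ne, hentry, Complex.ofReal_im]
      intro j _ hj
      rw [← hpair s hs hmem'.1 hmem'.2]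
      refine (hpair _ (hS j) ?_ ?_).symm
      · exact (hmem j a).2 (left_ne_zero_of_mul hj)
      · exact (hmem j b).2 (star_ne_zero.1 (right_ne_zero_of_mul hj))
    · rw [Finset.sum_eq_zero, Complex.zero_im]
      intro j hj
      obtain rfl : S j = s := by simpa using hj
      by_contra hne
      exact hmem' ⟨(hmem j a).2 (left_ne_zero_of_mul hne),
        (hmem j b).2 (star_ne_zero.1 (right_ne_zero_of_mul hne))⟩
  have hex (s : Finset (Fin n)) : ∃ w : Fin r → Fin n → ℝ, s.card ≤ 2 →
      (∀ j, ∀ a ∉ s, w j a = 0) ∧ ∀ a b, ∑ j with S j = s, w j a * w j b =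
        (∑ j with S j = s, v j a * star (v j b)).re := by
    by_cases hs : s.card ≤ 2
    · obtain ⟨w, hw⟩ := exists_real_outer_sum {j | S j = s} s hs v (fun j hj a ha => by
        obtain rfl : S j = s := by simpa using hj
        simpa [hmem] using ha) (him s hs)
      exact ⟨w, fun _ => hw⟩
    · exact ⟨0, fun h => absurd h hs⟩
  choose w hw using hex
  refine ⟨fun j => w (S j) j, fun j => ?_, ?_⟩
  · refine (Set.ncard_le_ncard (t := (S j : Set (Fin n))) (fun a ha => ?_)
      (Finset.finite_toSet _)).trans ((Set.ncard_coe_finset _).trans_le (hS j))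
    by_contra hna
    exact ha ((hw (S j) (hS j)).1 j a hna)
  · ext a b
    simp only [Matrix.sum_apply, Matrix.vecMulVec_apply, star_trivial]
    rw [← Complex.ofReal_re (A a b), ← hentry, ← Finset.sum_fiberwise Finset.univ S,
      ← Finset.sum_fiberwise Finset.univ S, Complex.re_sum]
    refine Finset.sum_congr rfl fun s _ => ?_
    by_cases hs : s.card ≤ 2
    · rw [← (hw s hs).2 a b]
      refine Finset.sum_congr rfl fun j hj => ?_
      rw [(Finset.mem_filter.1 hj).2]
    · have hempty : (Finset.univ.filter fun j => S j = s) = ∅ :=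
        Finset.filter_eq_empty_iff.2 fun j _ hj => hs (hj ▸ hS j)
      simp [hempty]

theorem fran_two_real_complex (A : Matrix (Fin n) (Fin n) ℝ)
    (hA : A.PosSemidef) (h2 : FactorWidthAtMost 2 A) :
    fran 2 (A.map (Complex.ofReal ·)) = fran 2 A := by
  unfold fran
  congr 1
  ext r
  exact ⟨HasFWDecomp.of_map_ofReal, HasFWDecomp.map_ofReal⟩
end

section
/- Let A be an n×n positive semidefinite arrowhead matrix over F (F = ℝ or ℂ), i.e., a_{i,j} = 0 whenever i ≠ 1, j ≠ 1, and i ≠ j. Then A has factor width at most 2, and fran_k(A) = rank(A) for every k ≥ 2. -/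
open Matrix
open scoped ComplexOrder

variable {𝕜 : Type*} [RCLike 𝕜] {n : ℕ}

/-- Every factor-width decomposition has at least `A.rank` terms. -/
theorem HasFWDecomp.rank_le {k r : ℕ} {A : Matrix (Fin n) (Fin n) 𝕜} (h : HasFWDecomp k r A) :
    A.rank ≤ r := by
  obtain ⟨v, -, hv⟩ := h
  have hM : A = (Matrix.of v)ᵀ * ((Matrix.of v)ᵀ)ᴴ := by
    ext i j
    simp [hv, Matrix.sum_apply, Matrix.mul_apply, Matrix.vecMulVec_apply]
  rw [hM]
  exact (Matrix.rank_mul_le_left _ _).trans (by simpa using Matrix.rank_le_width (Matrix.of v)ᵀ)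

theorem HasFWDecomp.mono {k l r : ℕ} (hkl : k ≤ l) {A : Matrix (Fin n) (Fin n) 𝕜}
    (h : HasFWDecomp k r A) : HasFWDecomp l r A :=
  let ⟨v, hk, hv⟩ := h
  ⟨v, fun j => (hk j).trans hkl, hv⟩

/-- If a diagonal entry of a positive semidefinite matrix vanishes, so does its column. -/
theorem Matrix.PosSemidef.apply_eq_zero_of_diag_eq_zero {m : Type*} [Fintype m] [DecidableEq m]
    {A : Matrix m m 𝕜} (hA : A.PosSemidef) {j : m} (hj : A j j = 0) (i : m) : A i j = 0 := by
  have h := (hA.dotProduct_mulVec_zero_iff (Pi.single j 1)).1 (by simp [hj])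
  simpa using congrFun h i

/-- A congruence `L D Lᴴ` with `D` diagonal, `L` invertible and the columns of `L` supported on at
most `k` entries gives a factor-width-`k` decomposition with as few terms as the rank. -/
theorem hasFWDecomp_rank_of_diagonal {k : ℕ} {A L : Matrix (Fin n) (Fin n) 𝕜} {d : Fin n → 𝕜}
    (hA : A.PosSemidef) (hL : IsUnit L) (hLk : ∀ j, {i | L i j ≠ 0}.ncard ≤ k)
    (h : A = L * Matrix.diagonal d * star L) : HasFWDecomp k A.rank A := by
  classical
  have hd : ∀ i, 0 ≤ d i := by
    rw [← Matrix.posSemidef_diagonal_iff, ← hL.posSemidef_star_right_conjugate_iff, ← h]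
    exact hA
  have hrank : A.rank = Fintype.card {i // d i ≠ 0} := by
    rw [h, Matrix.rank_mul_eq_left_of_isUnit_det _ _ ((Matrix.isUnit_iff_isUnit_det _).1 hL.star),
      Matrix.rank_mul_eq_right_of_isUnit_det _ _ ((Matrix.isUnit_iff_isUnit_det _).1 hL),
      Matrix.rank_diagonal]
  rw [hrank]
  let e := (Fintype.equivFin {i // d i ≠ 0}).symm
  let w : Fin n → Fin n → 𝕜 := fun m i => (√(RCLike.re (d m)) : ℝ) * L i m
  refine ⟨fun j => w (e j), fun j => ?_, ?_⟩
  · refine (Set.ncard_le_ncard ?_).trans (hLk (e j))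
    intro i hi
    exact right_ne_zero_of_mul hi
  · have hsq : ∀ m, ((√(RCLike.re (d m)) : ℝ) : 𝕜) * (√(RCLike.re (d m)) : ℝ) = d m := by
      intro m
      obtain ⟨h₁, h₂⟩ := RCLike.nonneg_iff.1 (hd m)
      rw [← RCLike.ofReal_mul, Real.mul_self_sqrt h₁]
      exact RCLike.conj_eq_iff_re.1 (RCLike.conj_eq_iff_im.2 h₂)
    rw [e.sum_comp fun m => Matrix.vecMulVec (w m) (star (w m)),
      ← Finset.sum_subtype (Finset.univ.filter fun i => d i ≠ 0) (by simp)
        fun m => Matrix.vecMulVec (w m) (star (w m)),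
      Finset.sum_filter_of_ne]
    · rw [h]
      ext i j
      rw [Matrix.mul_apply]
      simp only [Matrix.mul_diagonal, Matrix.sum_apply, Matrix.vecMulVec_apply,
        Matrix.star_apply, Pi.star_apply, w, star_mul', RCLike.star_def, RCLike.conj_ofReal]
      refine Finset.sum_congr rfl fun m _ => ?_
      linear_combination -(L i m * starRingEnd 𝕜 (L j m)) * hsq m
    · intro m _ hm hdm
      refine hm ?_
      ext i j
      simp [w, hdm, Matrix.vecMulVec_apply]

/-- A positive semidefinite arrowhead matrix is congruent to a diagonal matrix through a
unitriangular arrowhead matrix. -/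
theorem arrowhead_hasFWDecomp [NeZero n] (A : Matrix (Fin n) (Fin n) 𝕜)
    (hA : A.PosSemidef)
    (harrow : ∀ i j : Fin n, i ≠ 0 → j ≠ 0 → i ≠ j → A i j = 0) :
    HasFWDecomp 2 A.rank A := by
  let L : Matrix (Fin n) (Fin n) 𝕜 := Matrix.of fun i j =>
    if i = j then 1 else if i = 0 then A 0 j / A j j else 0
  let d : Fin n → 𝕜 := fun i => if i = 0 then
    A 0 0 - ∑ m ∈ Finset.univ.erase 0, L 0 m * A m m * star (L 0 m) else A i i
  have hL : IsUnit L := by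
    rw [Matrix.isUnit_iff_isUnit_det, Matrix.det_of_isUpperTriangular]
    · simp [L]
    · intro i j hij
      have hi : i ≠ 0 := by
        rintro rfl
        exact absurd hij (Fin.zero_le _).not_gt
      simp [L, hi, (show j < i from hij).ne']
  have hrow : ∀ i j, i ≠ 0 → L i j = if i = j then 1 else 0 := by
    intro i j hi
    simp [L, hi]
  have hcol : ∀ j, j ≠ 0 → L 0 j * A j j = A 0 j := by
    intro j hj
    by_cases h : A j j = 0
    · simp [h, hA.apply_eq_zero_of_diag_eq_zero h]
    · simp [L, hj.symm, h]
  have hd : ∀ j, j ≠ 0 → d j = A j j := fun j hj => if_neg hj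
  have hstar : ∀ i j, star (A j i) = A i j := hA.isHermitian.apply
  refine hasFWDecomp_rank_of_diagonal (L := L) (d := d) hA hL (fun j => ?_) ?_
  · refine (Set.ncard_le_ncard (t := {0, j}) ?_ (Set.toFinite _)).trans ?_
    · intro i hi
      by_contra h
      simp only [Set.mem_insert_iff, Set.mem_singleton_iff, not_or] at h
      exact hi (by simp [L, h])
    · exact (Set.ncard_insert_le _ _).trans (by simp)
  · ext i j
    rw [Matrix.mul_apply]
    simp only [Matrix.mul_diagonal, Matrix.star_apply]
    by_cases hi : i = 0
    · subst hi
      by_cases hj : j = 0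
      · subst hj
        rw [← Finset.add_sum_erase _ _ (Finset.mem_univ 0),
          Finset.sum_congr rfl (g := fun m => L 0 m * A m m * star (L 0 m))]
        · simp only [d, if_pos rfl]
          simp [show L 0 0 = 1 by simp [L], -Finset.sum_erase_eq_sub]
        · intro m hm
          rw [hd m (Finset.ne_of_mem_erase hm)]
      · simp [hrow j _ hj, apply_ite, hd, hj, hcol]
    · by_cases hj : j = 0
      · subst hj
        have := congrArg star (hcol i hi)
        simp only [star_mul', hstar] at this
        simp [hrow i _ hi, hd, hi, ← this, mul_comm]
      · by_cases hij : i = j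
        · subst hij
          simp [hrow i _ hi, apply_ite, hd, hi]
        · simp [hrow i _ hi, hrow j _ hj, hij, harrow i j hi hj hij]

theorem arrowhead_factorWidth [NeZero n] (A : Matrix (Fin n) (Fin n) 𝕜)
    (hA : A.PosSemidef)
    (harrow : ∀ i j : Fin n, i ≠ 0 → j ≠ 0 → i ≠ j → A i j = 0) :
    FactorWidthAtMost 2 A ∧ ∀ k, 2 ≤ k → fran k A = A.rank := by
  have h := arrowhead_hasFWDecomp A hA harrow
  refine ⟨⟨_, h⟩, fun k hk => le_antisymm (Nat.sInf_le (h.mono hk)) ?_⟩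
  exact le_csInf ⟨_, h.mono hk⟩ fun r hr => hr.rank_le
end

section
/- Let k ≥ 2 and let A be an n×n positive semidefinite matrix over F (F = ℝ or ℂ) with factor width at most k. Then fran_k(A) ≥ (2 / (k(k−1))) · nnzu(A), where nnzu(A) is the number of nonzero entries of A strictly above the main diagonal. -/
open Matrix
open scoped ComplexOrder

variable {𝕜 : Type*} [RCLike 𝕜] {n : ℕ}

/-- The number of nonzero entries of `A` strictly above the main diagonal. -/
noncomputable def nnzu (A : Matrix (Fin n) (Fin n) 𝕜) : ℕ :=
  ({p : Fin n × Fin n | p.1 < p.2 ∧ A p.1 p.2 ≠ 0}).ncard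


theorem Finset.card_filter_lt_le_choose_two {α : Type*} [LinearOrder α] (s : Finset α) :
    ((s ×ˢ s).filter fun p => p.1 < p.2).card ≤ s.card.choose 2 := by
  rw [← Finset.card_powersetCard]
  refine Finset.card_le_card_of_injOn (fun p => {p.1, p.2}) ?_ ?_
  · rintro ⟨a, b⟩ h
    simp only [Finset.coe_filter, Finset.mem_product, Set.mem_ofPred_eq] at h
    simp only [Finset.mem_coe, Finset.mem_powersetCard]
    refine ⟨?_, Finset.card_pair h.2.ne⟩
    simp [Finset.insert_subset_iff, h.1.1, h.1.2]
  · rintro ⟨a, b⟩ h ⟨c, d⟩ h' e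
    simp only [Finset.coe_filter, Set.mem_ofPred_eq] at h h'
    have e' : ({a, b} : Set α) = {c, d} := by
      simpa using congrArg (fun t : Finset α => (t : Set α)) e
    rcases Set.pair_eq_pair_iff.1 e' with ⟨rfl, rfl⟩ | ⟨rfl, rfl⟩
    · rfl
    · exact absurd h.2 h'.2.asymm

open Classical in
theorem HasFWDecomp.nnzu_le {k r : ℕ} {A : Matrix (Fin n) (Fin n) 𝕜} (h : HasFWDecomp k r A) :
    nnzu A ≤ r * k.choose 2 := by
  obtain ⟨v, hv, rfl⟩ := h
  let S (j : Fin r) : Finset (Fin n) := Finset.univ.filter fun i => v j i ≠ 0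
  let T (j : Fin r) : Finset (Fin n × Fin n) := (S j ×ˢ S j).filter fun p => p.1 < p.2
  have hT (j : Fin r) : (T j).card ≤ k.choose 2 := by
    refine (Finset.card_filter_lt_le_choose_two (S j)).trans (Nat.choose_le_choose 2 ?_)
    rw [← Set.ncard_coe_finset]
    simpa [S] using hv j
  have hsub : {p : Fin n × Fin n | p.1 < p.2 ∧
      (∑ j, Matrix.vecMulVec (v j) (star (v j))) p.1 p.2 ≠ 0} ⊆
      (Finset.univ.biUnion T : Finset (Fin n × Fin n)) := by
    rintro p ⟨hlt, hne⟩
    rw [Matrix.sum_apply] at hne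
    obtain ⟨j, -, hj⟩ := Finset.exists_ne_zero_of_sum_ne_zero hne
    simp only [Matrix.vecMulVec_apply, Pi.star_apply, ne_eq, mul_eq_zero, star_eq_zero,
      not_or] at hj
    simp only [Finset.mem_coe, Finset.mem_biUnion]
    exact ⟨j, Finset.mem_univ j, by simp [T, S, hj.1, hj.2, hlt]⟩
  calc nnzu _ ≤ (Finset.univ.biUnion T).card := by
        rw [← Set.ncard_coe_finset]
        exact Set.ncard_le_ncard hsub (Finset.finite_toSet _)
    _ ≤ (Finset.univ : Finset (Fin r)).card * k.choose 2 :=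
        Finset.card_biUnion_le_card_mul _ _ _ fun j _ => hT j
    _ = r * k.choose 2 := by simp

theorem fran_ge_nnzu_div (k : ℕ) (hk : 2 ≤ k) (A : Matrix (Fin n) (Fin n) 𝕜)
    (hA : A.PosSemidef) (hFW : FactorWidthAtMost k A) :
    (2 / ((k : ℝ) * ((k : ℝ) - 1))) * (nnzu A : ℝ) ≤ (fran k A : ℝ) := by
  have h : HasFWDecomp k (fran k A) A := Nat.sInf_mem hFW
  have hle : (nnzu A : ℝ) ≤ fran k A * (k.choose 2 : ℕ) := by exact_mod_cast h.nnzu_le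
  rw [Nat.cast_choose_two] at hle
  have hk' : (2 : ℝ) ≤ k := by exact_mod_cast hk
  have hpos : 0 < (k : ℝ) * ((k : ℝ) - 1) := mul_pos (by linarith) (by linarith)
  rw [div_mul_eq_mul_div, div_le_iff₀ hpos]
  linarith
end

section
/- Let s ≥ 1 be a real number, let n ≥ 3, and let A be an n×n real positive semidefinite matrix with all entries nonnegative and factor width at most 2. Then the entrywise power A^{⊙s}, with (i,j)-entry a_{i,j}^s (real power of a nonnegative number), is positive semidefinite and has factor width at most 2. -/
open Matrix
open scoped ComplexOrder

variable {𝕜 : Type*} [RCLike 𝕜] {n : ℕ}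

theorem Matrix.single_sub {α : Type*} [AddGroup α] (i j : Fin n) (a b : α) :
    single i j (a - b) = single i j a - single i j b := by
  rw [sub_eq_add_neg, single_add, ← single_neg, sub_eq_add_neg]

theorem Matrix.single_sum {ι α : Type*} [AddCommMonoid α] (i j : Fin n) (t : Finset ι)
    (f : ι → α) : single i j (∑ k ∈ t, f k) = ∑ k ∈ t, single i j (f k) :=
  map_sum (singleAddMonoidHom i j) f t

namespace FactorWidthAtMost

theorem zero (k : ℕ) : FactorWidthAtMost k (0 : Matrix (Fin n) (Fin n) 𝕜) :=
  ⟨0, Fin.elim0, fun j => j.elim0, by simp⟩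

theorem add {k : ℕ} {A B : Matrix (Fin n) (Fin n) 𝕜} (hA : FactorWidthAtMost k A)
    (hB : FactorWidthAtMost k B) : FactorWidthAtMost k (A + B) := by
  obtain ⟨r, v, hv, rfl⟩ := hA
  obtain ⟨t, w, hw, rfl⟩ := hB
  refine ⟨r + t, Fin.append v w, fun j => ?_, ?_⟩
  · refine Fin.addCases (fun i => ?_) (fun i => ?_) j
    · simpa using hv i
    · simpa using hw i
  · simp [Fin.sum_univ_add]

theorem sum {ι : Type*} {k : ℕ} (s : Finset ι) {A : ι → Matrix (Fin n) (Fin n) 𝕜}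
    (hA : ∀ i ∈ s, FactorWidthAtMost k (A i)) : FactorWidthAtMost k (∑ i ∈ s, A i) :=
  Finset.sum_induction A _ (fun _ _ => add) (zero k) hA

theorem vecMulVec_self {k : ℕ} {v : Fin n → 𝕜}
    (hv : ({i | v i ≠ 0} : Set (Fin n)).ncard ≤ k) :
    FactorWidthAtMost k (vecMulVec v (star v)) :=
  ⟨1, fun _ => v, fun _ => hv, by simp⟩

theorem posSemidef {k : ℕ} {A : Matrix (Fin n) (Fin n) 𝕜} (hA : FactorWidthAtMost k A) :
    A.PosSemidef := by
  obtain ⟨r, v, -, rfl⟩ := hA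
  exact posSemidef_sum _ fun j _ => posSemidef_vecMulVec_self_star (v j)

end FactorWidthAtMost

theorem ncard_support_single_add_single_le (i j : Fin n) (x y : 𝕜) :
    ({l | (Pi.single i x + Pi.single j y : Fin n → 𝕜) l ≠ 0} : Set (Fin n)).ncard ≤ 2 := by
  refine (Set.ncard_le_ncard (t := {i, j}) (fun l hl => ?_) (Set.toFinite _)).trans
    ((Set.ncard_insert_le i {j}).trans (by simp))
  by_contra h
  simp only [Set.mem_insert_iff, Set.mem_singleton_iff, not_or] at h
  exact hl (by simp [h.1, h.2])

theorem vecMulVec_single_add_single_self (i j : Fin n) (x y : ℝ) :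
    vecMulVec (Pi.single i x + Pi.single j y : Fin n → ℝ) (star (Pi.single i x + Pi.single j y)) =
      single i i (x * x) + single j j (y * y) + (single i j (x * y) + single j i (x * y)) := by
  have hsingle (k l : Fin n) (u w : ℝ) :
      vecMulVec (Pi.single k u) (Pi.single l w) = single k l (u * w) := by
    ext a b
    by_cases ha : a = k <;> by_cases hb : b = l <;>
      simp [vecMulVec_apply, ha, hb, Ne.symm]
  simp only [star_trivial, add_vecMulVec, vecMulVec_add, hsingle, mul_comm y x]
  abel

/-- A positive semidefinite `2 × 2` matrix placed at the indices `i`, `j` has factor width at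
most two. -/
theorem factorWidthAtMost_two_block (i j : Fin n) {x y b : ℝ} (hx : 0 ≤ x) (hy : 0 ≤ y)
    (hb : b ^ 2 ≤ x * y) :
    FactorWidthAtMost 2 (single i i x + single j j y + (single i j b + single j i b)) := by
  have key (u w : ℝ) := FactorWidthAtMost.vecMulVec_self
    (ncard_support_single_add_single_le i j u w)
  simp only [vecMulVec_single_add_single_self] at key
  rcases hx.eq_or_lt with rfl | hx
  · obtain rfl : b = 0 := by
      have : b ^ 2 = 0 := le_antisymm (by simpa using hb) (sq_nonneg b)
      simpa using this
    simpa [Real.mul_self_sqrt hy] using key 0 √y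
  · have hs : √x ≠ 0 := (Real.sqrt_pos.2 hx).ne'
    have hr : 0 ≤ y - b ^ 2 / x := by
      rw [sub_nonneg, div_le_iff₀ hx]
      linarith
    convert (key √x (b / √x)).add (key 0 √(y - b ^ 2 / x)) using 1
    have h1 : √x * (b / √x) = b := by field_simp
    have h2 : b / √x * (b / √x) = b ^ 2 / x := by
      rw [div_mul_div_comm, Real.mul_self_sqrt hx.le, sq]
    rw [h1, h2, Real.mul_self_sqrt hx.le, Real.mul_self_sqrt hr, single_sub]
    simp
    abel

/-- A symmetric matrix whose diagonal entries can be distributed among the off-diagonal pairs so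
that every resulting `2 × 2` block is positive semidefinite has factor width at most two. -/
theorem factorWidthAtMost_two_of_sum_le {B q : Matrix (Fin n) (Fin n) ℝ} (hB : B.IsSymm)
    (hq : ∀ i j, 0 ≤ q i j) (hqB : ∀ i j, i ≠ j → B i j ^ 2 ≤ q i j * q j i)
    (hsum : ∀ i, ∑ j ∈ Finset.univ.erase i, q i j ≤ B i i) : FactorWidthAtMost 2 B := by
  have hdecomp : B =
      ∑ i, single i i (B i i - ∑ j ∈ Finset.univ.erase i, q i j) +
      ∑ i, ∑ j ∈ Finset.univ.erase i,
        (single i i (q i j / 2) + single j j (q j i / 2) +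
          (single i j (B i j / 2) + single j i (B i j / 2))) := by
    have herase (f : Fin n → Fin n → Matrix (Fin n) (Fin n) ℝ) :
        ∑ i, ∑ j ∈ Finset.univ.erase i, f i j = ∑ i, ∑ j ∈ Finset.univ.erase i, f j i :=
      Finset.sum_comm' (by simp [eq_comm])
    have hsymm (i j : Fin n) : B j i = B i j := hB.apply i j
    simp only [Finset.sum_add_distrib]
    rw [herase fun i j => single j j (q j i / 2), herase fun i j => single j i (B i j / 2)]
    simp only [← Finset.sum_add_distrib]
    conv_lhs => rw [matrix_eq_sum_single B]
    refine Finset.sum_congr rfl fun i _ => ?_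
    rw [← Finset.add_sum_erase _ _ (Finset.mem_univ i), single_sub, single_sum]
    simp only [hsymm i, ← single_add, add_halves, Finset.sum_add_distrib]
    abel
  rw [hdecomp]
  refine .add (.sum _ fun i _ => ?_) (.sum _ fun i _ => .sum _ fun j hj => ?_)
  · simpa using factorWidthAtMost_two_block i i (sub_nonneg.2 (hsum i)) le_rfl (b := 0) (by simp)
  · refine factorWidthAtMost_two_block i j (by linarith [hq i j]) (by linarith [hq j i]) ?_
    have := hqB i j (Finset.ne_of_mem_erase hj).symm
    nlinarith

/-- The diagonal entries of a matrix of factor width at most two can be distributed among the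
off-diagonal pairs so that every resulting `2 × 2` block is positive semidefinite. -/
theorem FactorWidthAtMost.exists_sum_le {A : Matrix (Fin n) (Fin n) ℝ}
    (hA : FactorWidthAtMost 2 A) :
    ∃ p : Matrix (Fin n) (Fin n) ℝ, (∀ i j, 0 ≤ p i j) ∧ (∀ i j, A i j ^ 2 ≤ p i j * p j i) ∧
      ∀ i, ∑ j ∈ Finset.univ.erase i, p i j ≤ A i i := by
  obtain ⟨r, v, hv, rfl⟩ := hA
  refine ⟨fun i j => ∑ t with v t j ≠ 0, v t i ^ 2, fun i j => by positivity, fun i j => ?_,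
    fun i => ?_⟩
  · have hp (i j : Fin n) : ∑ t with v t j ≠ 0, v t i ^ 2 =
        ∑ t with v t i ≠ 0 ∧ v t j ≠ 0, v t i ^ 2 := by
      simp only [Finset.sum_filter]
      refine Finset.sum_congr rfl fun t _ => ?_
      by_cases h : v t i = 0 <;> simp [h]
    have hab : (∑ t, vecMulVec (v t) (star (v t))) i j =
        ∑ t with v t i ≠ 0 ∧ v t j ≠ 0, v t i * v t j := by
      simp only [Matrix.sum_apply, vecMulVec_apply, star_trivial, Finset.sum_filter]
      refine Finset.sum_congr rfl fun t _ => ?_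
      by_cases h : v t i = 0 <;> by_cases h' : v t j = 0 <;> simp [h, h']
    beta_reduce
    rw [hab, hp i j, hp j i]
    simp only [and_comm (a := v _ j ≠ 0)]
    exact Finset.sum_mul_sq_le_sq_mul_sq _ _ _
  · simp only [Matrix.sum_apply, vecMulVec_apply, star_trivial, Finset.sum_filter]
    rw [Finset.sum_comm]
    refine Finset.sum_le_sum fun t _ => ?_
    rw [← Finset.sum_filter, Finset.sum_const, nsmul_eq_mul, ← sq]
    by_cases h : v t i = 0
    · simp [h]
    · have hcard : ((Finset.univ.erase i).filter fun j => v t j ≠ 0).card ≤ 1 := by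
        have h2 := hv t
        rw [Set.ncard_eq_toFinset_card', Set.toFinset_ofPred] at h2
        rw [Finset.filter_erase, Finset.card_erase_of_mem (by simpa using h)]
        omega
      exact mul_le_of_le_one_left (sq_nonneg _) (by exact_mod_cast hcard)

theorem Real.sum_rpow_le_rpow_sum {ι : Type*} (t : Finset ι) {f : ι → ℝ} (hf : ∀ i, 0 ≤ f i)
    {s : ℝ} (hs : 1 ≤ s) : ∑ i ∈ t, f i ^ s ≤ (∑ i ∈ t, f i) ^ s := by
  classical
  induction t using Finset.induction_on with
  | empty => simp [Real.zero_rpow (by linarith : s ≠ 0)]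
  | insert a t ha ih =>
    rw [Finset.sum_insert ha, Finset.sum_insert ha]
    exact (add_le_add_right ih _).trans
      (Real.add_rpow_le_rpow_add (hf a) (Finset.sum_nonneg fun i _ => hf i) hs)

theorem rpow_factorWidthAtMost_two (hn : 3 ≤ n) (s : ℝ) (hs : 1 ≤ s)
    (A : Matrix (Fin n) (Fin n) ℝ) (hA : A.PosSemidef)
    (hnn : ∀ i j, 0 ≤ A i j) (hFW : FactorWidthAtMost 2 A) :
    (Matrix.of fun i j => (A i j) ^ s).PosSemidef ∧
    FactorWidthAtMost 2 (Matrix.of fun i j => (A i j) ^ s) := by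
  suffices h : FactorWidthAtMost 2 (Matrix.of fun i j => (A i j) ^ s) from ⟨h.posSemidef, h⟩
  obtain ⟨p, hp, hpA, hsum⟩ := hFW.exists_sum_le
  have hs0 : 0 ≤ s := by linarith
  refine factorWidthAtMost_two_of_sum_le (q := fun i j => p i j ^ s) ?_
    (fun i j => Real.rpow_nonneg (hp i j) s) (fun i j _ => ?_) fun i => ?_
  · ext i j
    have : A j i = A i j := by simpa using hA.isHermitian.apply i j
    simp [this]
  · rw [← Real.mul_rpow (hp i j) (hp j i), of_apply, sq, ← Real.mul_rpow (hnn i j) (hnn i j), ← sq]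
    exact Real.rpow_le_rpow (sq_nonneg _) (hpA i j) hs0
  · exact (Real.sum_rpow_le_rpow_sum _ (hp i) hs).trans
      (Real.rpow_le_rpow (Finset.sum_nonneg fun j _ => hp i j) (hsum i) hs0)
end
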